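/- Let F_{μν} = ∂_μ A_ν − ∂_ν A_μ be a solution of the sourceless Maxwell equations ∇_ν F^{μν} = 0 on a spacetime (M,g), and let X be a conformal Killing field of g. Then the Noether current H^μ_c[X] = −(1/4π)√|det g| (F^{μβ} L_X A_β − (1/4) F^{αβ}F_{αβ} X^μ) satisfies ∇_μ H^μ_c[X] = 0. -/

import Mathlib

/-!
Statement 3: Let F_{μν} = ∂_μ A_ν − ∂_ν A_μ be a solution of the sourceless Maxwell
equations ∇_ν F^{μν} = 0 on a four-dimensional spacetime (M,g), and let X be a conformal
Killing field of g.  Then the Noether current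
  H^μ_c[X] = −(1/4π)√|det g| (F^{μβ} L_X A_β − (1/4) F^{αβ}F_{αβ} X^μ)
satisfies ∇_μ H^μ_c[X] = 0 (a vector density, so its covariant divergence is ∂_μ H^μ_c[X]).
Formulated in local coordinates.
-/

noncomputable section

abbrev Pt4 := Fin 4 → ℝ

def pd (i : Fin 4) (f : Pt4 → ℝ) (x : Pt4) : ℝ := fderiv ℝ f x (Pi.single i 1)

def covOne (Γ : Fin 4 → Fin 4 → Fin 4 → Pt4 → ℝ) (A : Fin 4 → Pt4 → ℝ)
    (δ β : Fin 4) (x : Pt4) : ℝ :=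
  pd δ (A β) x - ∑ γ, Γ γ δ β x * A γ x

def lieOne (V A : Fin 4 → Pt4 → ℝ) (β : Fin 4) (x : Pt4) : ℝ :=
  ∑ γ, V γ x * pd γ (A β) x + ∑ γ, A γ x * pd β (V γ) x

def lower (g : Fin 4 → Fin 4 → Pt4 → ℝ) (V : Fin 4 → Pt4 → ℝ)
    (β : Fin 4) (y : Pt4) : ℝ :=
  ∑ γ, g β γ y * V γ y

/-- √|det g| -/
def volg (g : Fin 4 → Fin 4 → Pt4 → ℝ) (x : Pt4) : ℝ :=
  Real.sqrt |(Matrix.of fun i j : Fin 4 => g i j x).det|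

/-- Field strength with lowered indices: F_{ab} = ∂_a A_b − ∂_b A_a. -/
def FlowF (A : Fin 4 → Pt4 → ℝ) (a b : Fin 4) (x : Pt4) : ℝ :=
  pd a (A b) x - pd b (A a) x

/-- Field strength with raised indices: F^{ab} = g^{aα} g^{bβ} F_{αβ}. -/
def Fup (gi : Fin 4 → Fin 4 → Pt4 → ℝ) (A : Fin 4 → Pt4 → ℝ)
    (a b : Fin 4) (x : Pt4) : ℝ :=
  ∑ α, ∑ β, gi a α x * gi b β x * FlowF A α β x

/-- Covariant divergence ∇_ν F^{μν} of the antisymmetric (2,0)-tensor F^{μν}. -/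
def covDivF (gi : Fin 4 → Fin 4 → Pt4 → ℝ) (Γ : Fin 4 → Fin 4 → Fin 4 → Pt4 → ℝ)
    (A : Fin 4 → Pt4 → ℝ) (μ : Fin 4) (x : Pt4) : ℝ :=
  ∑ ν, (pd ν (fun y => Fup gi A μ ν y) x
    + ∑ l, Γ μ ν l x * Fup gi A l ν x
    + ∑ l, Γ ν ν l x * Fup gi A μ l x)

/-- The canonical Noether current H^μ_c[X] of the Maxwell field. -/
def noether (g gi : Fin 4 → Fin 4 → Pt4 → ℝ) (A X : Fin 4 → Pt4 → ℝ)
    (μ : Fin 4) (x : Pt4) : ℝ :=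
  -(1/(4*Real.pi)) * volg g x *
    ((∑ β, Fup gi A μ β x * lieOne X A β x)
      - (1/4) * (∑ α, ∑ β, Fup gi A α β x * FlowF A α β x) * X μ x)

open Matrix

/-- Jacobi's formula for the derivative of a determinant. -/
theorem hasFDerivAt_det {E n : Type*} [NormedAddCommGroup E] [NormedSpace ℝ E] [Fintype n]
    [DecidableEq n] {M : E → Matrix n n ℝ} {M' : n → n → E →L[ℝ] ℝ} {x : E}
    (h : ∀ i j, HasFDerivAt (fun y => M y i j) (M' i j) x) :
    HasFDerivAt (fun y => (M y).det) (∑ j, ∑ i, (M x).adjugate j i • M' i j) x := by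
  have key : HasFDerivAt (fun y => ∑ σ : Equiv.Perm n,
      ((Equiv.Perm.sign σ : ℤ) : ℝ) * ∏ i, M y (σ i) i) _ x :=
    HasFDerivAt.fun_sum fun σ _ =>
      (HasFDerivAt.finsetProd (u := Finset.univ) fun i _ => h (σ i) i).const_mul _
  simp only [det_apply']
  refine key.congr_fderiv ?_
  ext v
  have hcol : ∀ j, ∑ i, (M x).adjugate j i * M' i j v
      = ((M x).updateCol j fun i => M' i j v).det := by
    intro j
    rw [det_eq_sum_mul_adjugate_col _ j]
    refine Finset.sum_congr rfl fun i _ => ?_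
    rw [updateCol_self, mul_comm]
    congr 1
    rw [← transpose_apply (adjugate _), ← transpose_apply (adjugate _), adjugate_transpose,
      adjugate_transpose, adjugate_apply, adjugate_apply, ← updateRow_transpose]
    simp
  simp only [_root_.sum_apply, _root_.smul_apply, smul_eq_mul, hcol,
    det_apply', Finset.mul_sum]
  rw [Finset.sum_comm]
  refine Finset.sum_congr rfl fun j _ => Finset.sum_congr rfl fun σ _ => ?_
  rw [← Finset.mul_prod_erase _ _ (Finset.mem_univ j), updateCol_self, mul_comm (M' _ _ v)]
  congr 2
  refine Finset.prod_congr rfl fun k hk => ?_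
  rw [updateCol_ne (Finset.ne_of_mem_erase hk)]

theorem sum_sum_eq_trace {n : Type*} [Fintype n] (P Q K H : Matrix n n ℝ) :
    ∑ a, ∑ b, (∑ α, ∑ β, P a α * Q b β * K α β) * H a b = (P * K * Qᵀ * Hᵀ).trace := by
  simp only [trace, diag_apply, mul_apply, transpose_apply, Finset.sum_mul]
  refine Finset.sum_congr rfl fun a _ => Finset.sum_congr rfl fun b _ => ?_
  rw [Finset.sum_comm]
  refine Finset.sum_congr rfl fun β _ => Finset.sum_congr rfl fun α _ => ?_
  ring

/-- The algebraic core of the conformal invariance of the Maxwell Lagrangian: if the variation of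
`G` is `-2lG + BG + GBᵀ`, the variation of `F^{ab} F_{ab}` only involves the Lie derivative of
`F` and the conformal weight. -/
theorem trace_variation {n : Type*} [Fintype n] {G G' F F' B : Matrix n n ℝ} {l : ℝ}
    (hG : Gᵀ = G) (hF : Fᵀ = -F) (hG' : G' = (-2 * l) • G + B * G + G * Bᵀ) :
    (G' * F * Gᵀ * Fᵀ).trace + (G * F * G'ᵀ * Fᵀ).trace + (G * F' * Gᵀ * Fᵀ).trace
        + (G * F * Gᵀ * F'ᵀ).trace
      = -4 * l * (G * F * Gᵀ * Fᵀ).trace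
        + 2 * (G * F * Gᵀ * (F' + Bᵀ * F + F * B)ᵀ).trace := by
  have hsymm : G'ᵀ = G' := by
    rw [hG']
    simp only [transpose_add, transpose_smul, transpose_mul, hG, transpose_transpose]
    abel
  have h1 : (G * F' * G * F).trace = -(G * F * G * F'ᵀ).trace := by
    rw [← trace_transpose]
    simp only [transpose_mul, hG, hF, Matrix.mul_assoc, Matrix.neg_mul, trace_neg]
    rw [← Matrix.mul_assoc, trace_mul_comm, trace_mul_comm G, trace_mul_comm]
    simp only [Matrix.mul_assoc]
  have h2 : (G * F * G' * F).trace = (G' * F * G * F).trace := by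
    rw [Matrix.mul_assoc, trace_mul_comm]
    simp only [Matrix.mul_assoc]
  have h3 : (B * G * F * G * F).trace = (G * F * G * F * B).trace := by
    rw [trace_mul_comm _ B]
    simp only [Matrix.mul_assoc]
  have h4 : (G * Bᵀ * F * G * F).trace = (G * F * G * Bᵀ * F).trace := by
    rw [Matrix.mul_assoc, trace_mul_comm]
    simp only [Matrix.mul_assoc]
  have h5 : (G' * F * G * F).trace = -2 * l * (G * F * G * F).trace
      + (G * F * G * F * B).trace + (G * F * G * Bᵀ * F).trace := by
    rw [← h3, ← h4, hG']
    simp only [Matrix.add_mul, Matrix.smul_mul, trace_add, trace_smul, smul_eq_mul]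
  simp only [hsymm, hG, hF, transpose_add, transpose_mul, transpose_transpose, Matrix.mul_neg,
    Matrix.neg_mul, Matrix.mul_add, trace_add, trace_neg, ← Matrix.mul_assoc]
  rw [h1, h2, h5]
  ring

theorem ContDiff.pd {f : Pt4 → ℝ} (hf : ContDiff ℝ (⊤ : ℕ∞) f) (i : Fin 4) :
    ContDiff ℝ (⊤ : ℕ∞) (fun y => pd i f y) :=
  (hf.fderiv_right (m := (⊤ : ℕ∞)) (by simp)).clm_apply contDiff_const

theorem ContDiff.differentiable_of_smooth {f : Pt4 → ℝ} (hf : ContDiff ℝ (⊤ : ℕ∞) f) :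
    Differentiable ℝ f :=
  hf.differentiable (by simp)

theorem pd_mul (i : Fin 4) {f h : Pt4 → ℝ} {x : Pt4} (hf : DifferentiableAt ℝ f x)
    (hh : DifferentiableAt ℝ h x) :
    pd i (fun y => f y * h y) x = pd i f x * h x + f x * pd i h x := by
  simp only [pd, fderiv_fun_mul hf hh, _root_.add_apply, _root_.smul_apply, smul_eq_mul]
  ring

theorem pd_add (i : Fin 4) {f h : Pt4 → ℝ} {x : Pt4} (hf : DifferentiableAt ℝ f x)
    (hh : DifferentiableAt ℝ h x) :
    pd i (fun y => f y + h y) x = pd i f x + pd i h x := by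
  simp only [pd, fderiv_fun_add hf hh, _root_.add_apply]

theorem pd_sub (i : Fin 4) {f h : Pt4 → ℝ} {x : Pt4} (hf : DifferentiableAt ℝ f x)
    (hh : DifferentiableAt ℝ h x) :
    pd i (fun y => f y - h y) x = pd i f x - pd i h x := by
  simp only [pd, fderiv_fun_sub hf hh, _root_.sub_apply]

theorem pd_const_mul (i : Fin 4) (c : ℝ) {f : Pt4 → ℝ} {x : Pt4}
    (hf : DifferentiableAt ℝ f x) : pd i (fun y => c * f y) x = c * pd i f x := by
  simp only [pd, fderiv_const_mul hf, _root_.smul_apply, smul_eq_mul]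

theorem pd_sum {ι : Type*} [Fintype ι] (i : Fin 4) {f : ι → Pt4 → ℝ} {x : Pt4}
    (hf : ∀ j, DifferentiableAt ℝ (f j) x) :
    pd i (fun y => ∑ j, f j y) x = ∑ j, pd i (f j) x := by
  simp only [pd, fderiv_fun_sum fun j _ => hf j, _root_.sum_apply]

theorem pd_comm {f : Pt4 → ℝ} (hf : ContDiff ℝ (⊤ : ℕ∞) f) (i j : Fin 4) (x : Pt4) :
    pd i (fun y => pd j f y) x = pd j (fun y => pd i f y) x := by
  have hd : DifferentiableAt ℝ (fderiv ℝ f) x :=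
    ((hf.fderiv_right (m := (⊤ : ℕ∞)) (by simp)).differentiable (by simp)) x
  have hs := (hf.contDiffAt (x := x)).isSymmSndFDerivAt
    (by rw [minSmoothness_of_isRCLikeNormedField]; exact WithTop.coe_le_coe.2 (le_top (a := (2 : ℕ∞))))
  have h : ∀ v w : Pt4, fderiv ℝ (fun y => fderiv ℝ f y v) x w = fderiv ℝ (fderiv ℝ f) x w v := by
    intro v w
    rw [fderiv_clm_apply hd (differentiableAt_const v)]
    simp
  simp only [pd, h]
  exact hs _ _

theorem fderiv_eq_sum_pd (f : Pt4 → ℝ) (x v : Pt4) :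
    fderiv ℝ f x v = ∑ k, v k * pd k f x := by
  conv_lhs => rw [pi_eq_sum_univ' v]
  simp [pd]

section Metric

variable {g gi : Fin 4 → Fin 4 → Pt4 → ℝ} {Γ : Fin 4 → Fin 4 → Fin 4 → Pt4 → ℝ}
  {A X : Fin 4 → Pt4 → ℝ}

theorem contDiff_flowF (hA : ∀ μ, ContDiff ℝ (⊤ : ℕ∞) (A μ)) (a b : Fin 4) :
    ContDiff ℝ (⊤ : ℕ∞) (FlowF A a b) :=
  ((hA b).pd a).sub ((hA a).pd b)

theorem contDiff_fup (hgi : ∀ μ ν, ContDiff ℝ (⊤ : ℕ∞) (gi μ ν))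
    (hA : ∀ μ, ContDiff ℝ (⊤ : ℕ∞) (A μ)) (a b : Fin 4) :
    ContDiff ℝ (⊤ : ℕ∞) (Fup gi A a b) :=
  ContDiff.sum fun α _ => ContDiff.sum fun β _ =>
    ((hgi a α).mul (hgi b β)).mul (contDiff_flowF hA α β)

theorem contDiff_lieOne (hX : ∀ μ, ContDiff ℝ (⊤ : ℕ∞) (X μ))
    (hA : ∀ μ, ContDiff ℝ (⊤ : ℕ∞) (A μ)) (b : Fin 4) :
    ContDiff ℝ (⊤ : ℕ∞) (lieOne X A b) :=
  (ContDiff.sum fun γ _ => (hX γ).mul ((hA b).pd γ)).add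
    (ContDiff.sum fun γ _ => (hA γ).mul ((hX γ).pd b))

theorem flowF_antisymm (A : Fin 4 → Pt4 → ℝ) (a b : Fin 4) (x : Pt4) :
    FlowF A a b x = -FlowF A b a x := by
  simp only [FlowF]; ring

theorem fup_antisymm (gi : Fin 4 → Fin 4 → Pt4 → ℝ) (A : Fin 4 → Pt4 → ℝ) (a b : Fin 4)
    (x : Pt4) : Fup gi A a b x = -Fup gi A b a x := by
  simp only [Fup, ← Finset.sum_neg_distrib]
  rw [Finset.sum_comm]
  refine Finset.sum_congr rfl fun β _ => Finset.sum_congr rfl fun α _ => ?_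
  rw [flowF_antisymm A α β]; ring

/-- Contracting a symmetric with an antisymmetric array gives zero. -/
theorem sum_symm_mul_antisymm {n : Type*} [Fintype n] {S T : n → n → ℝ}
    (hS : ∀ a b, S a b = S b a) (hT : ∀ a b, T a b = -T b a) : ∑ a, ∑ b, S a b * T a b = 0 := by
  have h : ∑ a, ∑ b, S a b * T a b = -∑ a, ∑ b, S a b * T a b := by
    conv_lhs => rw [Finset.sum_comm]
    simp only [← Finset.sum_neg_distrib]
    refine Finset.sum_congr rfl fun a _ => Finset.sum_congr rfl fun b _ => ?_
    rw [hS b a, hT b a]; ring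
  linarith

theorem gi_mul_g
    (hinv : ∀ μ ν x, (∑ σ, gi μ σ x * g σ ν x) = if μ = ν then (1:ℝ) else 0)
    (x : Pt4) :
    (of fun i j : Fin 4 => gi i j x) * (of fun i j : Fin 4 => g i j x) = 1 := by
  ext i j
  simp [mul_apply, hinv, one_apply]

theorem g_mul_gi
    (hinv : ∀ μ ν x, (∑ σ, gi μ σ x * g σ ν x) = if μ = ν then (1:ℝ) else 0)
    (x : Pt4) :
    (of fun i j : Fin 4 => g i j x) * (of fun i j : Fin 4 => gi i j x) = 1 :=
  mul_eq_one_comm.mp (gi_mul_g hinv x)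

theorem gi_symm
    (hinv : ∀ μ ν x, (∑ σ, gi μ σ x * g σ ν x) = if μ = ν then (1:ℝ) else 0)
    (hgsym : ∀ μ ν x, g μ ν x = g ν μ x) (a b : Fin 4) (x : Pt4) :
    gi a b x = gi b a x := by
  have hg : (of fun i j : Fin 4 => g i j x)ᵀ = of fun i j : Fin 4 => g i j x := by
    ext i j; exact hgsym j i x
  have h := congrArg transpose (g_mul_gi hinv x)
  rw [transpose_mul, hg, transpose_one] at h
  have h2 := left_inv_eq_right_inv h (g_mul_gi hinv x)
  exact congrFun (congrFun h2 b) a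

theorem adjugate_eq
    (hinv : ∀ μ ν x, (∑ σ, gi μ σ x * g σ ν x) = if μ = ν then (1:ℝ) else 0)
    (x : Pt4) (a b : Fin 4) :
    (of fun i j : Fin 4 => g i j x).adjugate a b
      = (of fun i j : Fin 4 => g i j x).det * gi a b x := by
  have h := congrArg (· * of fun i j : Fin 4 => gi i j x)
    (adjugate_mul (of fun i j : Fin 4 => g i j x))
  simp only [Matrix.mul_assoc, g_mul_gi hinv x, Matrix.mul_one, Matrix.smul_mul,
    Matrix.one_mul] at h
  rw [h]; rfl

theorem hasFDerivAt_volg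
    (hinv : ∀ μ ν x, (∑ σ, gi μ σ x * g σ ν x) = if μ = ν then (1:ℝ) else 0)
    (hg : ∀ μ ν, ContDiff ℝ (⊤ : ℕ∞) (g μ ν))
    (hdet : ∀ x, (of fun i j : Fin 4 => g i j x).det ≠ 0) (x : Pt4) :
    HasFDerivAt (volg g)
      ((volg g x * (1 / 2)) • ∑ j, ∑ i, gi j i x • fderiv ℝ (g i j) x) x := by
  have hvol : ∀ y, volg g y = Real.exp (Real.log (of fun i j : Fin 4 => g i j y).det * (1 / 2)) := by
    intro y
    rw [volg, ← Real.log_abs, mul_one_div, ← Real.log_sqrt (abs_nonneg _),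
      Real.exp_log (Real.sqrt_pos.mpr (abs_pos.mpr (hdet y)))]
  have h := ((hasFDerivAt_det (M := fun y => of fun i j : Fin 4 => g i j y) fun i j =>
    ((hg i j).differentiable_of_smooth x).hasFDerivAt).log (hdet x)).mul_const (1 / 2 : ℝ) |>.exp
  rw [← hvol x] at h
  refine (h.congr_fderiv ?_).congr_of_eventuallyEq (Filter.Eventually.of_forall hvol)
  ext v
  simp only [adjugate_eq hinv, _root_.smul_apply, _root_.sum_apply, smul_eq_mul, mul_assoc,
    ← Finset.mul_sum]
  field_simp [hdet x]

theorem pd_volg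
    (hinv : ∀ μ ν x, (∑ σ, gi μ σ x * g σ ν x) = if μ = ν then (1:ℝ) else 0)
    (hg : ∀ μ ν, ContDiff ℝ (⊤ : ℕ∞) (g μ ν))
    (hdet : ∀ x, (of fun i j : Fin 4 => g i j x).det ≠ 0) (k : Fin 4) (x : Pt4) :
    pd k (volg g) x = volg g x * ((1 / 2) * ∑ j, ∑ i, gi j i x * pd k (g i j) x) := by
  rw [pd, (hasFDerivAt_volg hinv hg hdet x).fderiv]
  simp [pd, mul_assoc]

/-- The derivative of the inverse metric along `v`. -/
theorem fderiv_gi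
    (hinv : ∀ μ ν x, (∑ σ, gi μ σ x * g σ ν x) = if μ = ν then (1:ℝ) else 0)
    (hg : ∀ μ ν, ContDiff ℝ (⊤ : ℕ∞) (g μ ν))
    (hgi : ∀ μ ν, ContDiff ℝ (⊤ : ℕ∞) (gi μ ν)) (x v : Pt4) :
    (of fun a b : Fin 4 => fderiv ℝ (gi a b) x v)
      = -((of fun a b : Fin 4 => gi a b x) * (of fun a b : Fin 4 => fderiv ℝ (g a b) x v)
        * (of fun a b : Fin 4 => gi a b x)) := by
  have h : (of fun a b : Fin 4 => fderiv ℝ (gi a b) x v) * (of fun a b : Fin 4 => g a b x)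
      + (of fun a b : Fin 4 => gi a b x) * (of fun a b : Fin 4 => fderiv ℝ (g a b) x v) = 0 := by
    ext a b
    have hc : (fun y => ∑ σ, gi a σ y * g σ b y) = fun _ => if a = b then (1:ℝ) else 0 :=
      funext fun y => hinv a b y
    have hd := congrArg (fun f => fderiv ℝ f x v) hc
    rw [fderiv_fun_sum fun σ _ => ((hgi a σ).differentiable_of_smooth x).fun_mul
      ((hg σ b).differentiable_of_smooth x)] at hd
    simp only [fderiv_fun_mul ((hgi _ _).differentiable_of_smooth x)
      ((hg _ _).differentiable_of_smooth x), _root_.sum_apply, _root_.add_apply,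
      _root_.smul_apply, smul_eq_mul, Finset.sum_add_distrib] at hd
    simp only [Matrix.add_apply, mul_apply, of_apply]
    rw [add_comm]
    simpa [mul_comm] using hd
  have h2 := congrArg (· * of fun a b : Fin 4 => gi a b x) h
  simp only [Matrix.add_mul, Matrix.mul_assoc, g_mul_gi hinv x, Matrix.mul_one,
    Matrix.zero_mul] at h2
  rw [Matrix.mul_assoc]
  exact eq_neg_of_add_eq_zero_left h2

theorem christoffel_symm
    (hgsym : ∀ μ ν x, g μ ν x = g ν μ x)
    (hΓ : ∀ l μ ν x, Γ l μ ν x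
      = (1/2) * ∑ σ, gi l σ x * (pd μ (g σ ν) x + pd ν (g σ μ) x - pd σ (g μ ν) x))
    (l μ ν : Fin 4) (x : Pt4) : Γ l μ ν x = Γ l ν μ x := by
  have hs : g μ ν = g ν μ := funext fun y => hgsym μ ν y
  rw [hΓ, hΓ, hs]
  congr 1
  exact Finset.sum_congr rfl fun σ _ => by ring

theorem sum_christoffel
    (hgsym : ∀ μ ν x, g μ ν x = g ν μ x)
    (hinv : ∀ μ ν x, (∑ σ, gi μ σ x * g σ ν x) = if μ = ν then (1:ℝ) else 0)
    (hΓ : ∀ l μ ν x, Γ l μ ν x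
      = (1/2) * ∑ σ, gi l σ x * (pd μ (g σ ν) x + pd ν (g σ μ) x - pd σ (g μ ν) x))
    (l : Fin 4) (x : Pt4) :
    ∑ ν, Γ ν ν l x = (1 / 2) * ∑ j, ∑ i, gi j i x * pd l (g i j) x := by
  have hs : ∀ a b, g a b = g b a := fun a b => funext fun y => hgsym a b y
  have h0 := sum_symm_mul_antisymm (S := fun a b => gi a b x)
    (T := fun a b => pd a (g b l) x - pd b (g a l) x)
    (fun a b => gi_symm hinv hgsym a b x) (fun a b => by ring)
  simp only [hΓ, ← Finset.mul_sum]
  congr 1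
  rw [← add_zero (∑ j, ∑ i, gi j i x * pd l (g i j) x), ← h0, ← Finset.sum_add_distrib]
  refine Finset.sum_congr rfl fun ν _ => ?_
  rw [← Finset.sum_add_distrib]
  exact Finset.sum_congr rfl fun σ _ => by ring

theorem sum_christoffel_mul_g
    (hgsym : ∀ μ ν x, g μ ν x = g ν μ x)
    (hinv : ∀ μ ν x, (∑ σ, gi μ σ x * g σ ν x) = if μ = ν then (1:ℝ) else 0)
    (hΓ : ∀ l μ ν x, Γ l μ ν x
      = (1/2) * ∑ σ, gi l σ x * (pd μ (g σ ν) x + pd ν (g σ μ) x - pd σ (g μ ν) x))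
    (α β δ : Fin 4) (x : Pt4) :
    ∑ γ, Γ γ α β x * g γ δ x
      = (1 / 2) * (pd α (g δ β) x + pd β (g δ α) x - pd δ (g α β) x) := by
  simp only [hΓ, mul_assoc, ← Finset.mul_sum, Finset.sum_mul]
  congr 1
  rw [Finset.sum_comm]
  have h : ∀ σ, ∑ γ, gi γ σ x * ((pd α (g σ β) x + pd β (g σ α) x - pd σ (g α β) x) * g γ δ x)
      = (if σ = δ then (1:ℝ) else 0) * (pd α (g σ β) x + pd β (g σ α) x - pd σ (g α β) x) := by
    intro σ
    rw [← hinv σ δ x, Finset.sum_mul]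
    refine Finset.sum_congr rfl fun γ _ => ?_
    rw [gi_symm hinv hgsym γ σ]; ring
  simp [h]

/-- The conformal Killing equation, written with partial derivatives. -/
theorem conformalKilling_pd
    (hgsym : ∀ μ ν x, g μ ν x = g ν μ x)
    (hinv : ∀ μ ν x, (∑ σ, gi μ σ x * g σ ν x) = if μ = ν then (1:ℝ) else 0)
    (hΓ : ∀ l μ ν x, Γ l μ ν x
      = (1/2) * ∑ σ, gi l σ x * (pd μ (g σ ν) x + pd ν (g σ μ) x - pd σ (g μ ν) x))
    {l : ℝ} (hg : ∀ μ ν, ContDiff ℝ (⊤ : ℕ∞) (g μ ν))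
    (hX : ∀ μ, ContDiff ℝ (⊤ : ℕ∞) (X μ)) {x : Pt4} {α β : Fin 4}
    (h : covOne Γ (lower g X) α β x + covOne Γ (lower g X) β α x = 2 * l * g α β x) :
    fderiv ℝ (g α β) x (fun k => X k x)
      = 2 * l * g α β x - ∑ γ, pd α (X γ) x * g γ β x - ∑ γ, g α γ x * pd β (X γ) x := by
  have hs : ∀ a b, g a b = g b a := fun a b => funext fun y => hgsym a b y
  have hcov : ∀ a b, covOne Γ (lower g X) a b x = ∑ γ, (pd a (g b γ) x * X γ x
      + g b γ x * pd a (X γ) x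
      - (1 / 2) * (pd a (g γ b) x + pd b (g γ a) x - pd γ (g a b) x) * X γ x) := by
    intro a b
    have h1 : pd a (lower g X b) x = ∑ γ, (pd a (g b γ) x * X γ x + g b γ x * pd a (X γ) x) := by
      refine (pd_sum a fun γ => ((hg b γ).differentiable_of_smooth x).fun_mul
        ((hX γ).differentiable_of_smooth x)).trans (Finset.sum_congr rfl fun γ _ => ?_)
      exact pd_mul a ((hg b γ).differentiable_of_smooth x) ((hX γ).differentiable_of_smooth x)
    have h2 : ∑ γ, Γ γ a b x * lower g X γ x
        = ∑ δ, (∑ γ, Γ γ a b x * g γ δ x) * X δ x := by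
      simp only [lower, Finset.mul_sum, Finset.sum_mul]
      rw [Finset.sum_comm]
      exact Finset.sum_congr rfl fun _ _ => Finset.sum_congr rfl fun _ _ => by ring
    rw [covOne, h1, h2, Finset.sum_sub_distrib]
    simp only [sum_christoffel_mul_g hgsym hinv hΓ]
  rw [← h, hcov, hcov, fderiv_eq_sum_pd, ← Finset.sum_add_distrib, ← Finset.sum_sub_distrib,
    ← Finset.sum_sub_distrib]
  refine Finset.sum_congr rfl fun γ _ => ?_
  rw [hs γ β, hs γ α, hs β α]
  ring

/-- The conformal Killing equation for the inverse metric. -/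
theorem conformalKilling_gi
    (hgsym : ∀ μ ν x, g μ ν x = g ν μ x)
    (hinv : ∀ μ ν x, (∑ σ, gi μ σ x * g σ ν x) = if μ = ν then (1:ℝ) else 0)
    (hΓ : ∀ l μ ν x, Γ l μ ν x
      = (1/2) * ∑ σ, gi l σ x * (pd μ (g σ ν) x + pd ν (g σ μ) x - pd σ (g μ ν) x))
    {l : ℝ} (hg : ∀ μ ν, ContDiff ℝ (⊤ : ℕ∞) (g μ ν))
    (hgi : ∀ μ ν, ContDiff ℝ (⊤ : ℕ∞) (gi μ ν)) (hX : ∀ μ, ContDiff ℝ (⊤ : ℕ∞) (X μ)) {x : Pt4}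
    (h : ∀ α β, covOne Γ (lower g X) α β x + covOne Γ (lower g X) β α x = 2 * l * g α β x) :
    (of fun a b : Fin 4 => fderiv ℝ (gi a b) x (fun k => X k x))
      = (-2 * l) • (of fun a b : Fin 4 => gi a b x)
        + (of fun a b : Fin 4 => pd b (X a) x) * (of fun a b : Fin 4 => gi a b x)
        + (of fun a b : Fin 4 => gi a b x) * (of fun a b : Fin 4 => pd b (X a) x)ᵀ := by
  have hD : (of fun a b : Fin 4 => fderiv ℝ (g a b) x (fun k => X k x))
      = (2 * l) • (of fun a b : Fin 4 => g a b x)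
        - (of fun a b : Fin 4 => pd b (X a) x)ᵀ * (of fun a b : Fin 4 => g a b x)
        - (of fun a b : Fin 4 => g a b x) * (of fun a b : Fin 4 => pd b (X a) x) := by
    ext a b
    rw [of_apply, conformalKilling_pd hgsym hinv hΓ hg hX (h a b)]
    simp [mul_apply]
  rw [fderiv_gi hinv hg hgi, hD]
  simp only [Matrix.mul_sub, Matrix.sub_mul, Matrix.mul_smul, Matrix.smul_mul,
    gi_mul_g hinv x, Matrix.one_mul, ← Matrix.mul_assoc]
  rw [Matrix.mul_assoc _ (of fun a b : Fin 4 => g a b x), g_mul_gi hinv x, Matrix.mul_one,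
    neg_mul, neg_smul]
  abel

theorem fderiv_volg_add_div
    (hgsym : ∀ μ ν x, g μ ν x = g ν μ x)
    (hinv : ∀ μ ν x, (∑ σ, gi μ σ x * g σ ν x) = if μ = ν then (1:ℝ) else 0)
    (hΓ : ∀ l μ ν x, Γ l μ ν x
      = (1/2) * ∑ σ, gi l σ x * (pd μ (g σ ν) x + pd ν (g σ μ) x - pd σ (g μ ν) x))
    {l : ℝ} (hg : ∀ μ ν, ContDiff ℝ (⊤ : ℕ∞) (g μ ν))
    (hdet : ∀ x, (of fun i j : Fin 4 => g i j x).det ≠ 0)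
    (hX : ∀ μ, ContDiff ℝ (⊤ : ℕ∞) (X μ)) {x : Pt4}
    (h : ∀ α β, covOne Γ (lower g X) α β x + covOne Γ (lower g X) β α x = 2 * l * g α β x) :
    fderiv ℝ (volg g) x (fun k => X k x) + volg g x * ∑ k, pd k (X k) x = 4 * l * volg g x := by
  have h1 : ∀ j, ∑ i, gi j i x * ∑ γ, pd i (X γ) x * g γ j x
      = ∑ γ, ∑ i, pd i (X γ) x * (gi j i x * g γ j x) := fun j => by
    simp only [Finset.mul_sum]
    rw [Finset.sum_comm]
    exact Finset.sum_congr rfl fun _ _ => Finset.sum_congr rfl fun _ _ => by ring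
  have h2 : ∑ j, ∑ i, gi j i x * ∑ γ, pd i (X γ) x * g γ j x = ∑ k, pd k (X k) x := by
    simp only [h1]
    rw [Finset.sum_comm]
    refine Finset.sum_congr rfl fun γ _ => ?_
    rw [Finset.sum_comm]
    have h3 : ∀ i, ∑ j, pd i (X γ) x * (gi j i x * g γ j x)
        = pd i (X γ) x * if i = γ then 1 else 0 := fun i => by
      rw [← hinv i γ x, Finset.mul_sum]
      exact Finset.sum_congr rfl fun j _ => by rw [gi_symm hinv hgsym j i, hgsym γ j]
    simp [h3]
  have h4 : ∑ j, ∑ i, gi j i x * ∑ γ, g i γ x * pd j (X γ) x = ∑ k, pd k (X k) x := by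
    refine Finset.sum_congr rfl fun j _ => ?_
    simp only [Finset.mul_sum]
    rw [Finset.sum_comm]
    have h5 : ∀ γ, ∑ i, gi j i x * (g i γ x * pd j (X γ) x)
        = (if j = γ then 1 else 0) * pd j (X γ) x := fun γ => by
      rw [← hinv j γ x, Finset.sum_mul]
      exact Finset.sum_congr rfl fun i _ => by ring
    simp [h5]
  have h6 : ∑ j, ∑ i, gi j i x * (2 * l * g i j x) = 8 * l := by
    have h7 : ∀ j, ∑ i, gi j i x * (2 * l * g i j x) = 2 * l := fun j => by
      have h8 : ∑ i, gi j i x * (2 * l * g i j x) = 2 * l * ∑ i, gi j i x * g i j x := by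
        rw [Finset.mul_sum]
        exact Finset.sum_congr rfl fun i _ => by ring
      rw [h8, hinv, if_pos rfl, mul_one]
    simp only [h7, Finset.sum_const, Finset.card_univ, Fintype.card_fin, nsmul_eq_mul]
    push_cast
    ring
  rw [(hasFDerivAt_volg hinv hg hdet x).fderiv]
  simp only [_root_.smul_apply, _root_.sum_apply, smul_eq_mul,
    conformalKilling_pd hgsym hinv hΓ hg hX (h _ _), mul_sub, Finset.sum_sub_distrib, h2, h4, h6]
  ring

/-- The Maxwell equations in divergence form. -/
theorem sum_pd_volg_mul_fup
    (hgsym : ∀ μ ν x, g μ ν x = g ν μ x)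
    (hinv : ∀ μ ν x, (∑ σ, gi μ σ x * g σ ν x) = if μ = ν then (1:ℝ) else 0)
    (hΓ : ∀ l μ ν x, Γ l μ ν x
      = (1/2) * ∑ σ, gi l σ x * (pd μ (g σ ν) x + pd ν (g σ μ) x - pd σ (g μ ν) x))
    (hg : ∀ μ ν, ContDiff ℝ (⊤ : ℕ∞) (g μ ν))
    (hdet : ∀ x, (of fun i j : Fin 4 => g i j x).det ≠ 0)
    (hgi : ∀ μ ν, ContDiff ℝ (⊤ : ℕ∞) (gi μ ν)) (hA : ∀ μ, ContDiff ℝ (⊤ : ℕ∞) (A μ))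
    (μ : Fin 4) (x : Pt4) :
    ∑ ν, pd ν (fun y => volg g y * Fup gi A μ ν y) x = volg g x * covDivF gi Γ A μ x := by
  have h0 : ∑ ν, ∑ l, Γ μ ν l x * Fup gi A l ν x = 0 :=
    sum_symm_mul_antisymm (T := fun ν l => Fup gi A l ν x)
      (fun a b => christoffel_symm hgsym hΓ μ a b x) (fun a b => fup_antisymm gi A b a x)
  have h1 : ∑ ν, ∑ l, Γ ν ν l x * Fup gi A μ l x
      = ∑ l, ((1 / 2) * ∑ j, ∑ i, gi j i x * pd l (g i j) x) * Fup gi A μ l x := by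
    rw [Finset.sum_comm]
    refine Finset.sum_congr rfl fun l _ => ?_
    rw [← sum_christoffel hgsym hinv hΓ, Finset.sum_mul]
  simp only [covDivF, Finset.sum_add_distrib, h0, h1]
  rw [add_zero, ← Finset.sum_add_distrib, Finset.mul_sum]
  refine Finset.sum_congr rfl fun ν _ => ?_
  rw [pd_mul ν (hasFDerivAt_volg hinv hg hdet x).differentiableAt
    ((contDiff_fup hgi hA μ ν).differentiable_of_smooth x), pd_volg hinv hg hdet]
  ring

/-- The components `(L_X F)_{ab}` of the Lie derivative of the field strength. -/
def lieF (X A : Fin 4 → Pt4 → ℝ) (a b : Fin 4) (x : Pt4) : ℝ :=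
  fderiv ℝ (FlowF A a b) x (fun k => X k x)
    + ∑ γ, pd a (X γ) x * FlowF A γ b x + ∑ γ, FlowF A a γ x * pd b (X γ) x

/-- The Lie derivative commutes with the exterior derivative. -/
theorem pd_lieOne_sub (hA : ∀ μ, ContDiff ℝ (⊤ : ℕ∞) (A μ))
    (hX : ∀ μ, ContDiff ℝ (⊤ : ℕ∞) (X μ)) (a b : Fin 4) (x : Pt4) :
    pd a (lieOne X A b) x - pd b (lieOne X A a) x = lieF X A a b x := by
  have hl : ∀ a b, pd a (lieOne X A b) x
      = ∑ γ, (pd a (X γ) x * pd γ (A b) x + X γ x * pd a (fun y => pd γ (A b) y) x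
        + (pd a (A γ) x * pd b (X γ) x + A γ x * pd a (fun y => pd b (X γ) y) x)) := by
    intro a b
    have d1 : ∀ γ, DifferentiableAt ℝ (fun y => X γ y * pd γ (A b) y) x := fun γ =>
      ((hX γ).mul ((hA b).pd γ)).differentiable_of_smooth x
    have d2 : ∀ γ, DifferentiableAt ℝ (fun y => A γ y * pd b (X γ) y) x := fun γ =>
      ((hA γ).mul ((hX γ).pd b)).differentiable_of_smooth x
    refine (pd_add a (DifferentiableAt.fun_sum fun γ _ => d1 γ)
      (DifferentiableAt.fun_sum fun γ _ => d2 γ)).trans ?_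
    rw [pd_sum a d1, pd_sum a d2, ← Finset.sum_add_distrib]
    refine Finset.sum_congr rfl fun γ _ => ?_
    rw [pd_mul a ((hX γ).differentiable_of_smooth x) (((hA b).pd γ).differentiable_of_smooth x),
      pd_mul a ((hA γ).differentiable_of_smooth x) (((hX γ).pd b).differentiable_of_smooth x)]
  rw [hl, hl, lieF, fderiv_eq_sum_pd, ← Finset.sum_sub_distrib, ← Finset.sum_add_distrib,
    ← Finset.sum_add_distrib]
  refine Finset.sum_congr rfl fun γ _ => ?_
  have hF : pd γ (FlowF A a b) x
      = pd γ (fun y => pd a (A b) y) x - pd γ (fun y => pd b (A a) y) x :=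
    pd_sub γ (((hA b).pd a).differentiable_of_smooth x) (((hA a).pd b).differentiable_of_smooth x)
  rw [hF, pd_comm (hA b) a γ, pd_comm (hA a) b γ, pd_comm (hX γ) a b]
  simp only [FlowF]
  ring

theorem sum_fup_mul_pd_lieOne (gi : Fin 4 → Fin 4 → Pt4 → ℝ)
    (hA : ∀ μ, ContDiff ℝ (⊤ : ℕ∞) (A μ))
    (hX : ∀ μ, ContDiff ℝ (⊤ : ℕ∞) (X μ)) (x : Pt4) :
    ∑ a, ∑ b, Fup gi A a b x * pd a (lieOne X A b) x
      = (1 / 2) * ∑ a, ∑ b, Fup gi A a b x * lieF X A a b x := by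
  have h : ∑ a, ∑ b, Fup gi A a b x * pd b (lieOne X A a) x
      = -∑ a, ∑ b, Fup gi A a b x * pd a (lieOne X A b) x := by
    rw [Finset.sum_comm]
    simp only [← Finset.sum_neg_distrib]
    refine Finset.sum_congr rfl fun a _ => Finset.sum_congr rfl fun b _ => ?_
    rw [fup_antisymm]; ring
  simp only [← pd_lieOne_sub hA hX, mul_sub, Finset.sum_sub_distrib, h]
  ring

/-- The derivative of the Maxwell Lagrangian `F^{ab} F_{ab}` along a conformal Killing field. -/
theorem fderiv_lagrangian {l : ℝ} (hgi : ∀ μ ν, ContDiff ℝ (⊤ : ℕ∞) (gi μ ν))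
    (hA : ∀ μ, ContDiff ℝ (⊤ : ℕ∞) (A μ)) {x : Pt4} (hsymm : ∀ a b, gi a b x = gi b a x)
    (h : (of fun a b : Fin 4 => fderiv ℝ (gi a b) x (fun k => X k x))
      = (-2 * l) • (of fun a b : Fin 4 => gi a b x)
        + (of fun a b : Fin 4 => pd b (X a) x) * (of fun a b : Fin 4 => gi a b x)
        + (of fun a b : Fin 4 => gi a b x) * (of fun a b : Fin 4 => pd b (X a) x)ᵀ) :
    fderiv ℝ (fun y => ∑ a, ∑ b, Fup gi A a b y * FlowF A a b y) x (fun k => X k x)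
      = -4 * l * (∑ a, ∑ b, Fup gi A a b x * FlowF A a b x)
        + 2 * ∑ a, ∑ b, Fup gi A a b x * lieF X A a b x := by
  set G : Matrix (Fin 4) (Fin 4) ℝ := of fun a b => gi a b x with hG
  set G' : Matrix (Fin 4) (Fin 4) ℝ := of fun a b => fderiv ℝ (gi a b) x (fun k => X k x)
    with hG'
  set B : Matrix (Fin 4) (Fin 4) ℝ := of fun a b => pd b (X a) x with hB
  set F : Matrix (Fin 4) (Fin 4) ℝ := of fun a b => FlowF A a b x with hF
  set F' : Matrix (Fin 4) (Fin 4) ℝ := of fun a b => fderiv ℝ (FlowF A a b) x (fun k => X k x)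
    with hF'
  have key := trace_variation (G := G) (F := F) (F' := F') (B := B) (l := l)
    (by ext a b; exact hsymm b a) (by ext a b; exact flowF_antisymm A b a x) h
  have hlie : ∀ a b, lieF X A a b x = (F' + Bᵀ * F + F * B) a b := by
    intro a b
    simp [lieF, hF', hB, hF, mul_apply]
  have dgi : ∀ a b, DifferentiableAt ℝ (gi a b) x := fun a b =>
    (hgi a b).differentiable_of_smooth x
  have dF : ∀ a b, DifferentiableAt ℝ (FlowF A a b) x := fun a b =>
    (contDiff_flowF hA a b).differentiable_of_smooth x
  have dFup : ∀ a b, DifferentiableAt ℝ (Fup gi A a b) x := fun a b =>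
    (contDiff_fup hgi hA a b).differentiable_of_smooth x
  have hFup : ∀ a b, Fup gi A a b x = ∑ α, ∑ β, G a α * G b β * F α β := fun a b => rfl
  have hFup' : ∀ a b, fderiv ℝ (Fup gi A a b) x (fun k => X k x)
      = ∑ α, ∑ β, G' a α * G b β * F α β + ∑ α, ∑ β, G a α * G' b β * F α β
        + ∑ α, ∑ β, G a α * G b β * F' α β := by
    intro a b
    have e : Fup gi A a b = fun y => ∑ α, ∑ β, gi a α y * gi b β y * FlowF A α β y := rfl
    have d : ∀ α β, DifferentiableAt ℝ (fun y => gi a α y * gi b β y * FlowF A α β y) x :=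
      fun α β => ((dgi a α).fun_mul (dgi b β)).fun_mul (dF α β)
    rw [e, fderiv_fun_sum fun α _ => DifferentiableAt.fun_sum fun β _ => d α β, _root_.sum_apply,
      ← Finset.sum_add_distrib, ← Finset.sum_add_distrib]
    refine Finset.sum_congr rfl fun α _ => ?_
    rw [fderiv_fun_sum fun β _ => d α β, _root_.sum_apply, ← Finset.sum_add_distrib,
      ← Finset.sum_add_distrib]
    refine Finset.sum_congr rfl fun β _ => ?_
    rw [fderiv_fun_mul ((dgi a α).fun_mul (dgi b β)) (dF α β), fderiv_fun_mul (dgi a α) (dgi b β)]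
    simp only [_root_.add_apply, _root_.smul_apply, smul_eq_mul, hG, hG', hF, hF', of_apply]
    ring
  have hL : fderiv ℝ (fun y => ∑ a, ∑ b, Fup gi A a b y * FlowF A a b y) x (fun k => X k x)
      = ∑ a, ∑ b, (fderiv ℝ (Fup gi A a b) x (fun k => X k x) * F a b
        + Fup gi A a b x * F' a b) := by
    have d : ∀ a b, DifferentiableAt ℝ (fun y => Fup gi A a b y * FlowF A a b y) x :=
      fun a b => (dFup a b).fun_mul (dF a b)
    rw [fderiv_fun_sum fun a _ => DifferentiableAt.fun_sum fun b _ => d a b, _root_.sum_apply]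
    refine Finset.sum_congr rfl fun a _ => ?_
    rw [fderiv_fun_sum fun b _ => d a b, _root_.sum_apply]
    refine Finset.sum_congr rfl fun b _ => ?_
    rw [fderiv_fun_mul (dFup a b) (dF a b)]
    simp only [_root_.add_apply, _root_.smul_apply, smul_eq_mul, hF, hF', of_apply]
    ring
  have hFF : ∀ a b, FlowF A a b x = F a b := fun a b => rfl
  simp only [hL, hFup', hFup, hlie, hFF, add_mul, Finset.sum_add_distrib, sum_sum_eq_trace]
  exact key

end Metric

theorem maxwell_noether_current_conserved
    (g gi : Fin 4 → Fin 4 → Pt4 → ℝ)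
    (Γ : Fin 4 → Fin 4 → Fin 4 → Pt4 → ℝ)
    (A X : Fin 4 → Pt4 → ℝ) (lam : Pt4 → ℝ)
    (hg : ∀ μ ν, ContDiff ℝ (⊤ : ℕ∞) (g μ ν))
    (hgsym : ∀ μ ν x, g μ ν x = g ν μ x)
    (hdet : ∀ x, (Matrix.of fun i j : Fin 4 => g i j x).det ≠ 0)
    (hgi : ∀ μ ν, ContDiff ℝ (⊤ : ℕ∞) (gi μ ν))
    (hinv : ∀ μ ν x, (∑ σ, gi μ σ x * g σ ν x) = if μ = ν then (1:ℝ) else 0)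
    -- Γ is the Levi-Civita connection of g
    (hΓ : ∀ l μ ν x, Γ l μ ν x
      = (1/2) * ∑ σ, gi l σ x * (pd μ (g σ ν) x + pd ν (g σ μ) x - pd σ (g μ ν) x))
    (hA : ∀ μ, ContDiff ℝ (⊤ : ℕ∞) (A μ))
    (hX : ∀ μ, ContDiff ℝ (⊤ : ℕ∞) (X μ))
    (hlam : ContDiff ℝ (⊤ : ℕ∞) lam)
    -- X is a conformal Killing field of g: ∇_{(α}X_{β)} = λ g_{αβ}
    (hCKV : ∀ α β x,
      covOne Γ (lower g X) α β x + covOne Γ (lower g X) β α x = 2 * lam x * g α β x)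
    -- sourceless Maxwell equations: ∇_ν F^{μν} = 0
    (hMaxwell : ∀ μ x, covDivF gi Γ A μ x = 0)
    (x : Pt4) :
    ∑ μ, pd μ (fun y => noether g gi A X μ y) x = 0 := by
  set L : Pt4 → ℝ := fun y => ∑ a, ∑ b, Fup gi A a b y * FlowF A a b y with hL
  have dV : DifferentiableAt ℝ (volg g) x := (hasFDerivAt_volg hinv hg hdet x).differentiableAt
  have dX : ∀ μ, DifferentiableAt ℝ (X μ) x := fun μ => (hX μ).differentiable_of_smooth x
  have dL : DifferentiableAt ℝ L x :=
    (ContDiff.sum fun a _ => ContDiff.sum fun b _ =>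
      (contDiff_fup hgi hA a b).mul (contDiff_flowF hA a b)).differentiable_of_smooth x
  have dVF : ∀ a b, DifferentiableAt ℝ (fun y => volg g y * Fup gi A a b y) x := fun a b =>
    dV.fun_mul ((contDiff_fup hgi hA a b).differentiable_of_smooth x)
  have dl : ∀ b, DifferentiableAt ℝ (lieOne X A b) x := fun b =>
    (contDiff_lieOne hX hA b).differentiable_of_smooth x
  have dS : ∀ μ β, DifferentiableAt ℝ (fun y => volg g y * Fup gi A μ β y * lieOne X A β y) x :=
    fun μ β => (dVF μ β).fun_mul (dl β)
  have hN : ∀ μ, (fun y => noether g gi A X μ y)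
      = fun y => -(1 / (4 * Real.pi)) * ((∑ β, volg g y * Fup gi A μ β y * lieOne X A β y)
        - (1 / 4) * (volg g y * X μ y * L y)) := by
    intro μ
    funext y
    simp only [noether, mul_assoc, ← Finset.mul_sum, hL]
    ring
  have hpd : ∀ μ, pd μ (fun y => noether g gi A X μ y) x
      = -(1 / (4 * Real.pi)) *
        ((∑ β, (pd μ (fun y => volg g y * Fup gi A μ β y) x * lieOne X A β x
            + volg g x * (Fup gi A μ β x * pd μ (lieOne X A β) x)))
          - (1 / 4) * (X μ x * pd μ (volg g) x * L x + volg g x * pd μ (X μ) x * L x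
            + volg g x * (X μ x * pd μ L x))) := by
    intro μ
    have dT := (dV.fun_mul (dX μ)).fun_mul dL
    have dU := DifferentiableAt.fun_sum (u := Finset.univ) fun β _ => dS μ β
    rw [hN, pd_const_mul μ _ (dU.fun_sub (dT.const_mul _)), pd_sub μ dU (dT.const_mul _),
      pd_const_mul μ _ dT, pd_sum μ (dS μ), pd_mul μ (dV.fun_mul (dX μ)) dL, pd_mul μ dV (dX μ)]
    congr 2
    · exact Finset.sum_congr rfl fun β _ => by rw [pd_mul μ (dVF μ β) (dl β)]; ring
    · ring
  have hM : ∑ μ, ∑ β, pd μ (fun y => volg g y * Fup gi A μ β y) x * lieOne X A β x = 0 := by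
    rw [Finset.sum_comm]
    refine Finset.sum_eq_zero fun β _ => ?_
    have h := sum_pd_volg_mul_fup hgsym hinv hΓ hg hdet hgi hA β x
    rw [hMaxwell, mul_zero] at h
    have hneg : ∀ μ, pd μ (fun y => volg g y * Fup gi A μ β y) x
        = -1 * pd μ (fun y => volg g y * Fup gi A β μ y) x := by
      intro μ
      rw [← pd_const_mul μ (-1) (dVF β μ)]
      congr 1
      funext y
      rw [fup_antisymm]; ring
    rw [← Finset.sum_mul]
    simp only [hneg, ← Finset.mul_sum, h]
    ring
  have hV := fderiv_volg_add_div hgsym hinv hΓ hg hdet hX fun α β => hCKV α β x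
  have hLag := fderiv_lagrangian hgi hA (fun a b => gi_symm hinv hgsym a b x)
    (conformalKilling_gi hgsym hinv hΓ hg hgi hX fun α β => hCKV α β x)
  rw [fderiv_eq_sum_pd] at hV hLag
  simp only [hpd, ← Finset.mul_sum, Finset.sum_sub_distrib, Finset.sum_add_distrib, hM,
    sum_fup_mul_pd_lieOne gi hA hX, ← Finset.sum_mul]
  rw [hLag]
  change -(1 / (4 * Real.pi)) * (0 + _ - 1 / 4 * (_ + _ + volg g x * (-4 * lam x * L x + _))) = 0
  linear_combination (1 / (4 * Real.pi)) * (1 / 4) * L x * hV
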